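/- arXiv:1504.03175 — 3 statements merged into one kernel-verified Lean document; each statement's English description precedes it below -/
import Mathlib

section
/- For every k ∈ ℕ, sup_{x ∈ [0,1)} W(k)(x) = 2; in particular ‖W(k)‖_{L^∞([0,1))} = 2. -/
open MeasureTheory Finset
open scoped ENNReal

noncomputable section

/-- The `j`-th binary digit (`j ≥ 1`) of a real number `x ∈ [0,1)`
(using the binary expansion in which infinitely many digits are `0`). -/
def bdigit (x : ℝ) (j : ℕ) : ℕ := ⌊x * 2 ^ j⌋.toNat % 2

/-- The `k`-th (dyadic) Walsh function. -/
def walsh (k : ℕ) (x : ℝ) : ℝ :=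
  (-1 : ℝ) ^ (∑ j ∈ Finset.range k, if k.testBit j then bdigit x (j + 1) else 0)

/-- The multi-dimensional Walsh function. -/
def walshV {s : ℕ} (k : Fin s → ℕ) (x : Fin s → ℝ) : ℝ := ∏ i, walsh (k i) (x i)

/-- The half-open unit cube `[0,1)^s`. -/
def unitCube (s : ℕ) : Set (Fin s → ℝ) := Set.univ.pi fun _ => Set.Ico (0 : ℝ) 1

/-- The closed unit cube `[0,1]^s`. -/
def closedCube (s : ℕ) : Set (Fin s → ℝ) := Set.univ.pi fun _ => Set.Icc (0 : ℝ) 1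

/-- The `k`-th Walsh coefficient of `f`. -/
def walshCoeff {s : ℕ} (f : (Fin s → ℝ) → ℝ) (k : Fin s → ℕ) : ℝ :=
  ∫ x in unitCube s, f x * walshV k x

/-- `z ⊕ 2^{-n}` : flipping the `n`-th binary digit of `z`. -/
def oplus (z : ℝ) (n : ℕ) : ℝ := z + (-1) ^ bdigit z n * ((2 : ℝ) ^ n)⁻¹

/-- The dyadic difference `∂_{i,n}`. -/
def dyadicDiff {s : ℕ} (i : Fin s) (n : ℕ) (g : (Fin s → ℝ) → ℝ) (x : Fin s → ℝ) : ℝ :=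
  2 ^ n * (g (Function.update x i (oplus (x i) n)) - g x)

/-- The function `χ_n`. -/
def chi (n : ℕ) (x y : ℝ) : ℝ :=
  if min x (oplus x n) ≤ y ∧ y ≤ max x (oplus x n) then 2 ^ n else 0

/-- The exponents in the binary expansion of `k`, in decreasing order. -/
def bitsDesc (k : ℕ) : List ℕ := ((List.range k).filter fun j => k.testBit j).reverse

/-- The number `N` of nonzero binary digits of `k`. -/
def numBits (k : ℕ) : ℕ := (bitsDesc k).length

/-- The weight `μ'_u(k) = ∑_{j=1}^{min(u,N)} (a_j + 2)` for scalar `k`. -/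
def muW (u k : ℕ) : ℕ := (((bitsDesc k).take u).map (· + 2)).sum

/-- The weight `μ'_u(k)` for vectors. -/
def muWV {s : ℕ} (u k : Fin s → ℕ) : ℕ := ∑ i, muW (u i) (k i)

/-- `k_{≤}^{u}` : the `u` most significant binary digits of `k`. -/
def kLe (u k : ℕ) : ℕ := (((bitsDesc k).take u).map (2 ^ ·)).sum

/-- `k_{>}^{u}` : the remaining binary digits of `k`. -/
def kGt (u k : ℕ) : ℕ := (((bitsDesc k).drop u).map (2 ^ ·)).sum

/-- The functions `W(k)`, defined inductively by stripping the least significant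
binary digit of `k` (whose exponent is the 2-adic valuation of `k`). -/
def Wfun : ℕ → ℝ → ℝ
  | 0 => fun _ => 1
  | (k + 1) => fun y =>
      ∫ x in Set.Ico (0 : ℝ) 1,
        chi ((k + 1).factorization 2 + 1) x y *
          Wfun ((k + 1) - 2 ^ ((k + 1).factorization 2)) x
  decreasing_by exact Nat.sub_lt (Nat.succ_pos k) (Nat.two_pow_pos _)

/-- Composition of the dyadic differences `∂_{i,a+1}` for `a` running over a list. -/
def dCompCoord {s : ℕ} (i : Fin s) (L : List ℕ) (g : (Fin s → ℝ) → ℝ) : (Fin s → ℝ) → ℝ :=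
  L.foldr (fun a h => dyadicDiff i (a + 1) h) g

/-- The operator `d_{k_u}` : composition over all coordinates `i` of the dyadic
differences `∂_{i,a_{i,j}+1}`, `1 ≤ j ≤ min(u_i, N_i)`. -/
def dComp {s : ℕ} (u k : Fin s → ℕ) (f : (Fin s → ℝ) → ℝ) : (Fin s → ℝ) → ℝ :=
  (List.finRange s).foldr (fun i g => dCompCoord i ((bitsDesc (k i)).take (u i)) g) f

/-- The multi-index `ν` increased by one in coordinate `i`. -/
def addE {s : ℕ} (i : Fin s) (ν : Fin s → ℕ) : Fin s → ℕ := Function.update ν i (ν i + 1)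

/-- `D` is a family of mixed partial derivatives of `f`, of orders up to `u_i` in
the variable `x_i`, each continuous on the closed cube `[0,1]^s`. -/
def HasMixedDerivs {s : ℕ} (u : Fin s → ℕ) (f : (Fin s → ℝ) → ℝ)
    (D : (Fin s → ℕ) → (Fin s → ℝ) → ℝ) : Prop :=
  D (fun _ => 0) = f ∧
    (∀ ν : Fin s → ℕ, (∀ j, ν j ≤ u j) → ContinuousOn (D ν) (closedCube s)) ∧
    ∀ (ν : Fin s → ℕ) (i : Fin s), (∀ j, addE i ν j ≤ u j) →
      ∀ x ∈ closedCube s,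
        HasDerivWithinAt (fun t => D ν (Function.update x i t)) (D (addE i ν) x)
          (Set.Icc 0 1) (x i)

/-- `∫_{[0,1)^{s-|v|}} F dx_{S∖v}` : the inner integral over the coordinates outside `v`
(as a function of the coordinates in `v`). -/
def projInt {s : ℕ} (v : Finset (Fin s)) (F : (Fin s → ℝ) → ℝ) (x : Fin s → ℝ) : ℝ :=
  ∫ y in unitCube s, F fun i => if i ∈ v then x i else y i

/-- The mixed norm `‖F^{(·)}‖_p` : the `L^p` norm (over the coordinates in `v`) of the
integral of `F` over the coordinates outside `v`. -/
def mixedNorm {s : ℕ} (p : ℝ≥0∞) (v : Finset (Fin s)) (F : (Fin s → ℝ) → ℝ) : ℝ≥0∞ :=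
  eLpNorm (projInt v F) p (volume.restrict (unitCube s))

/-- The `ℓ^q` norm of a finite family in `ℝ≥0∞`, with the usual modification at `q = ∞`. -/
def lqNorm {ι : Type*} [Fintype ι] (q : ℝ≥0∞) (a : ι → ℝ≥0∞) : ℝ≥0∞ :=
  if q = ∞ then ⨆ i, a i else (∑ i, a i ^ q.toReal) ^ q.toReal⁻¹

/-- The `h`-th point of the digital net generated by the matrices `C i`. -/
def netPoint {s m n : ℕ} (C : Fin s → Matrix (Fin n) (Fin m) (ZMod 2)) (h : Fin (2 ^ m)) :
    Fin s → ℝ :=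
  fun i => ∑ j : Fin n,
    (((∑ l : Fin m, (if (h : ℕ).testBit (l : ℕ) then (1 : ZMod 2) else 0) * C i j l).val : ℝ) *
      ((2 : ℝ) ^ ((j : ℕ) + 1))⁻¹)

/-- Membership of `k ∈ ℕ₀^s` in the dual net `P^⊥`. -/
def inDual {s m n : ℕ} (C : Fin s → Matrix (Fin n) (Fin m) (ZMod 2)) (k : Fin s → ℕ) : Prop :=
  ∀ l : Fin m, ∑ i, ∑ j : Fin n, C i j l * (if (k i).testBit (j : ℕ) then (1 : ZMod 2) else 0) = 0

open Classical in
/-- `∑_{k_v ∈ P_v^⊥} 2^{-μ'_α(k_v)}`, encoded as a sum over all `k ∈ ℕ₀^s`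
with support exactly `v` lying in the dual net. -/
def dualSum {s m n : ℕ} (α : ℕ) (C : Fin s → Matrix (Fin n) (Fin m) (ZMod 2))
    (v : Finset (Fin s)) : ℝ≥0∞ :=
  ∑' k : Fin s → ℕ,
    if (∀ i, i ∈ v ↔ k i ≠ 0) ∧ inDual C k
    then (2 : ℝ≥0∞) ^ (-(muWV (fun _ => α) k : ℝ)) else 0


lemma oplus_eq_of_floor {x : ℝ} {n : ℕ} {q : ℤ} (hq : ⌊x * 2 ^ n⌋ = q) (hx : 0 ≤ x) :
    oplus x n = if Even q then x + ((2 : ℝ) ^ n)⁻¹ else x - ((2 : ℝ) ^ n)⁻¹ := by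
  have hq0 : 0 ≤ q := hq ▸ Int.floor_nonneg.mpr (by positivity)
  lift q to ℕ using hq0
  rw [oplus, bdigit, hq, Int.toNat_natCast]
  simp only [Int.even_coe_nat]
  split_ifs with he
  · rw [Nat.even_iff.mp he]; ring
  · rw [Nat.not_even_iff.mp he]; ring

lemma floor_mul_two_pow_iff {x : ℝ} {n : ℕ} {q : ℤ} :
    ⌊x * 2 ^ n⌋ = q ↔ q * ((2 : ℝ) ^ n)⁻¹ ≤ x ∧ x < (q + 1) * ((2 : ℝ) ^ n)⁻¹ := by
  rw [Int.floor_eq_iff, ← div_eq_mul_inv, ← div_eq_mul_inv, div_le_iff₀ (by positivity),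
    lt_div_iff₀ (by positivity)]

lemma int_lt_of_mul_lt {h : ℝ} (hh : 0 < h) {a b : ℤ} (hab : (a : ℝ) * h < b * h) : a < b := by
  exact_mod_cast lt_of_mul_lt_mul_right hab hh.le

lemma chi_eq_indicator_of_even {x y : ℝ} {n : ℕ} {r : ℤ} (hr : ⌊y * 2 ^ n⌋ = r) (he : Even r)
    (hx : 0 ≤ x) :
    chi n x y = (Set.Icc (r * ((2 : ℝ) ^ n)⁻¹) y ∪
      Set.Icc ((r + 1) * ((2 : ℝ) ^ n)⁻¹) (y + ((2 : ℝ) ^ n)⁻¹)).indicator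
        (fun _ => (2 : ℝ) ^ n) x := by
  obtain ⟨q, hq⟩ : ∃ q, ⌊x * 2 ^ n⌋ = q := ⟨_, rfl⟩
  rw [chi, oplus_eq_of_floor hq hx, Set.indicator_apply]
  rw [floor_mul_two_pow_iff] at hr hq
  have hh : 0 < ((2 : ℝ) ^ n)⁻¹ := by positivity
  generalize ((2 : ℝ) ^ n)⁻¹ = h at *
  refine if_congr ?_ rfl rfl
  simp only [Set.mem_union, Set.mem_Icc]
  split_ifs with hqe
  · rw [min_eq_left (by linarith), max_eq_right (by linarith)]
    constructor
    · rintro ⟨h1, h2⟩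
      have hlt : r < q + 2 := int_lt_of_mul_lt hh (by push_cast; linarith)
      have hle : q < r + 1 := int_lt_of_mul_lt hh (by push_cast; linarith)
      obtain rfl : q = r := by
        rcases he with ⟨i, rfl⟩; rcases hqe with ⟨j, rfl⟩; omega
      exact Or.inl ⟨hq.1, h1⟩
    · rintro (⟨h1, h2⟩ | ⟨h1, h2⟩)
      · have hle : r < q + 1 := int_lt_of_mul_lt hh (by push_cast; linarith)
        have hle' : (r : ℝ) ≤ q := by exact_mod_cast (by omega : r ≤ q)
        exact ⟨h2, by nlinarith⟩
      · have hlt : q < r + 2 := int_lt_of_mul_lt hh (by push_cast; linarith)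
        have hlt' : r + 1 < q + 1 := int_lt_of_mul_lt hh (by push_cast; linarith)
        exfalso
        rcases he with ⟨i, rfl⟩; rcases hqe with ⟨j, rfl⟩; omega
  · rw [min_eq_right (by linarith), max_eq_left (by linarith)]
    rw [Int.not_even_iff_odd] at hqe
    constructor
    · rintro ⟨h1, h2⟩
      have hlt : q < r + 2 := int_lt_of_mul_lt hh (by push_cast; linarith)
      have hle : r < q + 1 := int_lt_of_mul_lt hh (by push_cast; linarith)
      obtain rfl : q = r + 1 := by
        rcases he with ⟨i, rfl⟩; rcases hqe with ⟨j, rfl⟩; omega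
      push_cast at hq
      exact Or.inr ⟨hq.1, by linarith⟩
    · rintro (⟨h1, h2⟩ | ⟨h1, h2⟩)
      · have hle : r < q + 1 := int_lt_of_mul_lt hh (by push_cast; linarith)
        have hlt : q < r + 1 := int_lt_of_mul_lt hh (by push_cast; linarith)
        exfalso
        rcases he with ⟨i, rfl⟩; rcases hqe with ⟨j, rfl⟩; omega
      · exact ⟨by linarith, by linarith⟩

lemma chi_eq_indicator_of_odd {x y : ℝ} {n : ℕ} {r : ℤ} (hr : ⌊y * 2 ^ n⌋ = r) (ho : Odd r)
    (hx : 0 ≤ x) :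
    chi n x y = (Set.Ico (y - ((2 : ℝ) ^ n)⁻¹) (r * ((2 : ℝ) ^ n)⁻¹) ∪
      Set.Ico y ((r + 1) * ((2 : ℝ) ^ n)⁻¹)).indicator (fun _ => (2 : ℝ) ^ n) x := by
  obtain ⟨q, hq⟩ : ∃ q, ⌊x * 2 ^ n⌋ = q := ⟨_, rfl⟩
  rw [chi, oplus_eq_of_floor hq hx, Set.indicator_apply]
  rw [floor_mul_two_pow_iff] at hr hq
  have hh : 0 < ((2 : ℝ) ^ n)⁻¹ := by positivity
  generalize ((2 : ℝ) ^ n)⁻¹ = h at *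
  refine if_congr ?_ rfl rfl
  simp only [Set.mem_union, Set.mem_Ico]
  split_ifs with hqe
  · rw [min_eq_left (by linarith), max_eq_right (by linarith)]
    constructor
    · rintro ⟨h1, h2⟩
      have hlt : r < q + 2 := int_lt_of_mul_lt hh (by push_cast; linarith)
      have hle : q < r + 1 := int_lt_of_mul_lt hh (by push_cast; linarith)
      obtain rfl : r = q + 1 := by
        rcases ho with ⟨i, rfl⟩; rcases hqe with ⟨j, rfl⟩; omega
      push_cast at hr ⊢
      exact Or.inl ⟨by linarith, hq.2⟩
    · rintro (⟨h1, h2⟩ | ⟨h1, h2⟩)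
      · exact ⟨by linarith, by linarith⟩
      · have hlt : q < r + 1 := int_lt_of_mul_lt hh (by push_cast; linarith)
        have hlt' : r < q + 1 := int_lt_of_mul_lt hh (by push_cast; linarith)
        exfalso
        rcases ho with ⟨i, rfl⟩; rcases hqe with ⟨j, rfl⟩; omega
  · rw [min_eq_right (by linarith), max_eq_left (by linarith)]
    rw [Int.not_even_iff_odd] at hqe
    constructor
    · rintro ⟨h1, h2⟩
      have hlt : q < r + 2 := int_lt_of_mul_lt hh (by push_cast; linarith)
      have hle : r < q + 1 := int_lt_of_mul_lt hh (by push_cast; linarith)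
      obtain rfl : q = r := by
        rcases ho with ⟨i, rfl⟩; rcases hqe with ⟨j, rfl⟩; omega
      exact Or.inr ⟨h2, hq.2⟩
    · rintro (⟨h1, h2⟩ | ⟨h1, h2⟩)
      · have hlt : q < r := int_lt_of_mul_lt hh (by linarith)
        have hlt' : r < q + 2 := int_lt_of_mul_lt hh (by push_cast; linarith)
        exfalso
        rcases ho with ⟨i, rfl⟩; rcases hqe with ⟨j, rfl⟩; omega
      · have hlt : q < r + 1 := int_lt_of_mul_lt hh (by push_cast; linarith)
        have hle' : (q : ℝ) ≤ r := by exact_mod_cast (by omega : q ≤ r)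
        exact ⟨by nlinarith, h1⟩

lemma setIntegral_indicator_union_mul {f : ℝ → ℝ} (hf : Continuous f) {S A B : Set ℝ} {c : ℝ}
    (hS : MeasurableSet S) (hA : MeasurableSet A) (hB : MeasurableSet B) (hAS : A ⊆ S)
    (hBS : B ⊆ S) (hAB : Disjoint A B) (hbdd : S ⊆ Set.Icc 0 1) {g : ℝ → ℝ}
    (hg : ∀ x ∈ S, g x = (A ∪ B).indicator (fun _ => c) x) :
    ∫ x in S, g x * f x = c * ((∫ x in A, f x) + ∫ x in B, f x) := by
  have hint : IntegrableOn f S := (hf.integrableOn_Icc).mono_set hbdd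
  calc ∫ x in S, g x * f x
      = ∫ x in S, (A ∪ B).indicator (fun x => c * f x) x := by
        refine setIntegral_congr_fun hS fun x hx => ?_
        by_cases hxAB : x ∈ A ∪ B <;> simp only [hg x hx, Set.indicator_of_mem,
          Set.indicator_of_notMem, hxAB, not_false_eq_true, zero_mul]
    _ = ∫ x in A ∪ B, c * f x := by
        rw [setIntegral_indicator (hA.union hB),
          Set.inter_eq_self_of_subset_right (Set.union_subset hAS hBS)]
    _ = c * ((∫ x in A, f x) + ∫ x in B, f x) := by
        rw [integral_const_mul,
          setIntegral_union hAB hB (hint.mono_set hAS) (hint.mono_set hBS)]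

lemma Function.Periodic.intervalIntegral_shift {f : ℝ → ℝ} {p : ℝ} (hf : Function.Periodic f p)
    (a b : ℝ) : ∫ x in (a + p)..(b + p), f x = ∫ x in a..b, f x := by
  rw [← intervalIntegral.integral_comp_add_right]
  exact intervalIntegral.integral_congr fun x _ => hf x

lemma integral_chi_mul_of_even {f : ℝ → ℝ} (hf : Continuous f) {n : ℕ}
    (hp : Function.Periodic f ((2 : ℝ) ^ n)⁻¹) {y : ℝ} {r : ℤ} (hr : ⌊y * 2 ^ n⌋ = r)
    (he : Even r) (hn : 1 ≤ n) (hy : y ∈ Set.Ico (0 : ℝ) 1) :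
    ∫ x in Set.Ico (0 : ℝ) 1, chi n x y * f x
      = 2 * 2 ^ n * ∫ x in (r * ((2 : ℝ) ^ n)⁻¹)..y, f x := by
  have hr' := floor_mul_two_pow_iff.mp hr
  have hh : 0 < ((2 : ℝ) ^ n)⁻¹ := by positivity
  have hr0 : (0 : ℝ) ≤ r := by
    exact_mod_cast hr ▸ Int.floor_nonneg.mpr (mul_nonneg hy.1 (by positivity))
  have htop : (r + 2) * ((2 : ℝ) ^ n)⁻¹ ≤ 1 := by
    have h1 : (2 : ℝ) ^ n * ((2 : ℝ) ^ n)⁻¹ = 1 := mul_inv_cancel₀ (by positivity)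
    have h2 : r < 2 ^ n := by
      apply int_lt_of_mul_lt hh
      push_cast
      linarith [hy.2]
    have h3 : r + 2 ≤ 2 ^ n := by
      obtain ⟨m, rfl⟩ := Nat.exists_eq_add_of_le hn
      obtain ⟨i, rfl⟩ := he
      rw [pow_add] at h2 ⊢
      omega
    calc (r + 2) * ((2 : ℝ) ^ n)⁻¹ ≤ 2 ^ n * ((2 : ℝ) ^ n)⁻¹ := by
          gcongr
          exact_mod_cast h3
      _ = 1 := h1
  rw [setIntegral_indicator_union_mul hf measurableSet_Ico measurableSet_Icc measurableSet_Icc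
    ?_ ?_ ?_ Set.Ico_subset_Icc_self (fun x hx => chi_eq_indicator_of_even hr he hx.1),
    integral_Icc_eq_integral_Ioc, integral_Icc_eq_integral_Ioc,
    ← intervalIntegral.integral_of_le hr'.1, ← intervalIntegral.integral_of_le (by linarith),
    add_mul, one_mul, hp.intervalIntegral_shift]
  · ring
  · intro x hx
    have := mul_nonneg hr0 hh.le
    exact ⟨this.trans hx.1, hx.2.trans_lt hy.2⟩
  · intro x hx
    have := mul_nonneg hr0 hh.le
    exact ⟨by linarith [hx.1], by linarith [hx.2]⟩
  · rw [Set.disjoint_left]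
    intro x hx hx'
    linarith [hx.2, hx'.1]

lemma integral_chi_mul_of_odd {f : ℝ → ℝ} (hf : Continuous f) {n : ℕ}
    (hp : Function.Periodic f ((2 : ℝ) ^ n)⁻¹) {y : ℝ} {r : ℤ} (hr : ⌊y * 2 ^ n⌋ = r)
    (ho : Odd r) (hy : y ∈ Set.Ico (0 : ℝ) 1) :
    ∫ x in Set.Ico (0 : ℝ) 1, chi n x y * f x
      = 2 * 2 ^ n * ∫ x in y..((r + 1) * ((2 : ℝ) ^ n)⁻¹), f x := by
  have hr' := floor_mul_two_pow_iff.mp hr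
  have hh : 0 < ((2 : ℝ) ^ n)⁻¹ := by positivity
  have hr0 : (1 : ℝ) ≤ r := by
    have : 0 ≤ r := hr ▸ Int.floor_nonneg.mpr (mul_nonneg hy.1 (by positivity))
    obtain ⟨i, rfl⟩ := ho
    exact_mod_cast (by omega : 1 ≤ 2 * i + 1)
  have htop : (r + 1) * ((2 : ℝ) ^ n)⁻¹ ≤ 1 := by
    have h1 : (2 : ℝ) ^ n * ((2 : ℝ) ^ n)⁻¹ = 1 := mul_inv_cancel₀ (by positivity)
    have h2 : r < 2 ^ n := by
      apply int_lt_of_mul_lt hh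
      push_cast
      linarith [hy.2]
    calc (r + 1) * ((2 : ℝ) ^ n)⁻¹ ≤ 2 ^ n * ((2 : ℝ) ^ n)⁻¹ := by
          gcongr
          exact_mod_cast h2
      _ = 1 := h1
  rw [setIntegral_indicator_union_mul hf measurableSet_Ico measurableSet_Ico measurableSet_Ico
    ?_ ?_ ?_ Set.Ico_subset_Icc_self (fun x hx => chi_eq_indicator_of_odd hr ho hx.1),
    integral_Ico_eq_integral_Ioc, integral_Ico_eq_integral_Ioc,
    ← intervalIntegral.integral_of_le (by linarith),
    ← intervalIntegral.integral_of_le (by linarith), ← hp.intervalIntegral_shift (y - _),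
    sub_add_cancel, add_mul, one_mul]
  · ring
  · intro x hx
    have : 0 ≤ (r - 1) * ((2 : ℝ) ^ n)⁻¹ := mul_nonneg (by linarith) hh.le
    exact ⟨by linarith [hx.1], by linarith [hx.2]⟩
  · intro x hx
    exact ⟨hy.1.trans hx.1, hx.2.trans_le htop⟩
  · rw [Set.disjoint_left]
    intro x hx hx'
    linarith [hx.2, hx'.1]

/-- The tent function over the primitive of `f`: a multiple of the distance from `∫₀ʸ f` to the
nearest multiple of `2 ^ (1 - n)`. -/
def primitiveTent (n : ℕ) (f : ℝ → ℝ) (y : ℝ) : ℝ :=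
  2 * 2 ^ n * ‖((∫ t in (0 : ℝ)..y, f t : ℝ) : AddCircle (2 * ((2 : ℝ) ^ n)⁻¹))‖

/-- Continuous functions with values in `[0,2]`, of period `2 ^ (-n)` and of mean one. -/
structure IsMeanOne (n : ℕ) (f : ℝ → ℝ) : Prop where
  continuous : Continuous f
  periodic : Function.Periodic f ((2 : ℝ) ^ n)⁻¹
  nonneg : ∀ x, 0 ≤ f x
  le_two : ∀ x, f x ≤ 2
  integral_eq : ∫ x in (0 : ℝ)..1, f x = 1

namespace IsMeanOne

variable {n : ℕ} {f : ℝ → ℝ}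

lemma integral_period (hf : IsMeanOne n f) (y : ℝ) :
    ∫ x in y..(y + ((2 : ℝ) ^ n)⁻¹), f x = ((2 : ℝ) ^ n)⁻¹ := by
  have h := hf.periodic.intervalIntegral_add_zsmul_eq (2 ^ n) 0
    (fun a b => hf.continuous.intervalIntegrable a b)
  have h1 : (2 : ℝ) ^ n * ((2 : ℝ) ^ n)⁻¹ = 1 := mul_inv_cancel₀ (by positivity)
  simp only [zsmul_eq_mul, Int.cast_pow, Int.cast_ofNat, h1, zero_add] at h
  rw [hf.integral_eq] at h
  rw [hf.periodic.intervalIntegral_add_eq y 0, zero_add]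
  exact eq_inv_of_mul_eq_one_right h.symm

lemma integral_mul_period (hf : IsMeanOne n f) (m : ℤ) :
    ∫ x in (0 : ℝ)..(m * ((2 : ℝ) ^ n)⁻¹), f x = m * ((2 : ℝ) ^ n)⁻¹ := by
  have h := hf.periodic.intervalIntegral_add_zsmul_eq m 0
    (fun a b => hf.continuous.intervalIntegrable a b)
  rw [hf.integral_period] at h
  simpa using h

lemma primitive_add_period (hf : IsMeanOne n f) (y : ℝ) :
    ∫ x in (0 : ℝ)..(y + ((2 : ℝ) ^ n)⁻¹), f x
      = (∫ x in (0 : ℝ)..y, f x) + ((2 : ℝ) ^ n)⁻¹ := by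
  rw [← intervalIntegral.integral_add_adjacent_intervals (b := y)
    (hf.continuous.intervalIntegrable _ _) (hf.continuous.intervalIntegrable _ _),
    hf.integral_period]

end IsMeanOne

lemma AddCircle.coe_sub_int_mul_period (p u : ℝ) (m : ℤ) :
    ((u - m * p : ℝ) : AddCircle p) = u := by
  rw [AddCircle.coe_sub, sub_eq_self, AddCircle.coe_eq_zero_iff]
  exact ⟨m, by simp⟩

lemma AddCircle.norm_coe_of_abs_sub_le {h u : ℝ} (hh : 0 < h) (m : ℤ)
    (hu : |u - m * (2 * h)| ≤ h) : ‖(u : AddCircle (2 * h))‖ = |u - m * (2 * h)| := by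
  rw [← AddCircle.coe_sub_int_mul_period _ u m, AddCircle.norm_coe_eq_abs_iff _ (by positivity),
    abs_of_pos (by positivity : 0 < 2 * h)]
  linarith

lemma AddCircle.norm_coe_add_half {h : ℝ} (hh : 0 < h) (u : ℝ) :
    ‖((u + h : ℝ) : AddCircle (2 * h))‖ = h - ‖(u : AddCircle (2 * h))‖ := by
  obtain ⟨m, hm⟩ : ∃ m : ℤ, |u - m * (2 * h)| ≤ h := by
    refine ⟨round (u / (2 * h)), ?_⟩
    have h1 := abs_sub_round (u / (2 * h))
    have h2 : u - round (u / (2 * h)) * (2 * h)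
        = (u / (2 * h) - round (u / (2 * h))) * (2 * h) := by
      field_simp
    rw [h2, abs_mul, abs_of_pos (by positivity : 0 < 2 * h)]
    nlinarith
  rw [AddCircle.norm_coe_of_abs_sub_le hh m hm]
  obtain ⟨h1, h2⟩ := abs_le.mp hm
  rcases le_total 0 (u - m * (2 * h)) with h0 | h0
  · have key : u + h - ((m + 1 : ℤ) : ℝ) * (2 * h) = -(h - (u - m * (2 * h))) := by
      push_cast; ring
    have habs : |u + h - ((m + 1 : ℤ) : ℝ) * (2 * h)| = h - (u - m * (2 * h)) := by
      rw [key, abs_neg, abs_of_nonneg (by linarith)]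
    rw [AddCircle.norm_coe_of_abs_sub_le hh (m + 1) (by rw [habs]; linarith), habs,
      abs_of_nonneg h0]
  · have habs : |u + h - m * (2 * h)| = h + (u - m * (2 * h)) := by
      rw [abs_of_nonneg (by linarith)]; ring
    rw [AddCircle.norm_coe_of_abs_sub_le hh m (by rw [habs]; linarith), habs,
      abs_of_nonpos h0]
    ring

namespace IsMeanOne

variable {n : ℕ} {f : ℝ → ℝ}

lemma continuous_primitive (hf : IsMeanOne n f) :
    Continuous fun y => ∫ x in (0 : ℝ)..y, f x :=
  intervalIntegral.continuous_primitive (fun a b => hf.continuous.intervalIntegrable a b) 0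

lemma primitiveTent_add_half (hf : IsMeanOne n f) (y : ℝ) :
    primitiveTent n f (y + ((2 : ℝ) ^ n)⁻¹) = 2 - primitiveTent n f y := by
  have h1 : (2 : ℝ) ^ n * ((2 : ℝ) ^ n)⁻¹ = 1 := mul_inv_cancel₀ (by positivity)
  rw [primitiveTent, primitiveTent, hf.primitive_add_period,
    AddCircle.norm_coe_add_half (by positivity)]
  linear_combination 2 * h1

lemma mono {m : ℕ} (hf : IsMeanOne n f) (hmn : m ≤ n) : IsMeanOne m f where
  __ := hf
  periodic := by
    obtain ⟨d, rfl⟩ := Nat.exists_eq_add_of_le hmn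
    have h : ((2 : ℝ) ^ m)⁻¹ = (2 ^ d : ℕ) * ((2 : ℝ) ^ (m + d))⁻¹ := by
      push_cast
      rw [pow_add]
      field_simp
    rw [h]
    exact hf.periodic.nat_mul _

lemma primitiveTent (hf : IsMeanOne (n + 1) f) : IsMeanOne n (primitiveTent (n + 1) f) := by
  have hcont : Continuous (_root_.primitiveTent (n + 1) f) :=
    continuous_const.mul (((AddCircle.continuous_mk' _).comp hf.continuous_primitive).norm)
  have hnonneg : ∀ x, 0 ≤ _root_.primitiveTent (n + 1) f x := fun x => by
    unfold _root_.primitiveTent; positivity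
  have hper : Function.Periodic (_root_.primitiveTent (n + 1) f) ((2 : ℝ) ^ n)⁻¹ := fun x => by
    have h : ((2 : ℝ) ^ n)⁻¹ = ((2 : ℝ) ^ (n + 1))⁻¹ + ((2 : ℝ) ^ (n + 1))⁻¹ := by
      rw [pow_succ]; field_simp; norm_num
    rw [h, ← add_assoc, hf.primitiveTent_add_half, hf.primitiveTent_add_half]
    ring
  refine ⟨hcont, hper, hnonneg, fun x => ?_, ?_⟩
  · have := hf.primitiveTent_add_half x
    linarith [hnonneg (x + ((2 : ℝ) ^ (n + 1))⁻¹)]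
  · have hper1 : Function.Periodic (_root_.primitiveTent (n + 1) f) 1 := by
      have := hper.nat_mul (2 ^ n)
      rwa [Nat.cast_pow, Nat.cast_ofNat, mul_inv_cancel₀ (by positivity)] at this
    have h1 := hper1.intervalIntegral_add_eq ((2 : ℝ) ^ (n + 1))⁻¹ 0
    rw [zero_add, add_comm _ (1 : ℝ)] at h1
    have h2 : ∫ x in (0 : ℝ)..1, _root_.primitiveTent (n + 1) f (x + ((2 : ℝ) ^ (n + 1))⁻¹)
        = ∫ x in (0 : ℝ)..1, _root_.primitiveTent (n + 1) f x := by
      rw [intervalIntegral.integral_comp_add_right, zero_add, h1]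
    simp only [hf.primitiveTent_add_half] at h2
    rw [intervalIntegral.integral_sub (by simp) (hcont.intervalIntegrable _ _),
      intervalIntegral.integral_const] at h2
    simp only [sub_zero, smul_eq_mul, one_mul] at h2
    linarith

lemma primitiveTent_half (hf : IsMeanOne n f) :
    _root_.primitiveTent n f ((2 : ℝ) ^ n)⁻¹ = 2 := by
  have h := hf.primitiveTent_add_half 0
  rw [zero_add] at h
  rw [h]
  simp [_root_.primitiveTent]

lemma integral_chi_mul (hf : IsMeanOne n f) (hn : 1 ≤ n) {y : ℝ} (hy : y ∈ Set.Ico (0 : ℝ) 1) :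
    ∫ x in Set.Ico (0 : ℝ) 1, chi n x y * f x = _root_.primitiveTent n f y := by
  obtain ⟨r, hr⟩ : ∃ r, ⌊y * 2 ^ n⌋ = r := ⟨_, rfl⟩
  have hr' := floor_mul_two_pow_iff.mp hr
  have hh : 0 < ((2 : ℝ) ^ n)⁻¹ := by positivity
  have hint : ∀ a b, IntervalIntegrable f volume a b :=
    fun a b => hf.continuous.intervalIntegrable a b
  have hcell := hf.integral_period (r * ((2 : ℝ) ^ n)⁻¹)
  rw [← add_one_mul, ← intervalIntegral.integral_add_adjacent_intervals (hint _ y) (hint y _)]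
    at hcell
  have hleft : 0 ≤ ∫ x in (r * ((2 : ℝ) ^ n)⁻¹)..y, f x :=
    intervalIntegral.integral_nonneg hr'.1 fun x _ => hf.nonneg x
  have hright : 0 ≤ ∫ x in y..((r + 1) * ((2 : ℝ) ^ n)⁻¹), f x :=
    intervalIntegral.integral_nonneg hr'.2.le fun x _ => hf.nonneg x
  have hprim := intervalIntegral.integral_add_adjacent_intervals (hint 0 (r * ((2 : ℝ) ^ n)⁻¹))
    (hint _ y)
  rw [hf.integral_mul_period] at hprim
  unfold _root_.primitiveTent
  rcases Int.even_or_odd r with he | ho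
  · rw [integral_chi_mul_of_even hf.continuous hf.periodic hr he hn hy]
    obtain ⟨i, rfl⟩ := he
    have hsub : (∫ x in (0 : ℝ)..y, f x) - i * (2 * ((2 : ℝ) ^ n)⁻¹)
        = ∫ x in ((i + i : ℤ) * ((2 : ℝ) ^ n)⁻¹)..y, f x := by
      rw [← hprim]; push_cast; ring
    rw [AddCircle.norm_coe_of_abs_sub_le hh i (by rw [hsub, abs_of_nonneg hleft]; linarith),
      hsub, abs_of_nonneg hleft]
  · rw [integral_chi_mul_of_odd hf.continuous hf.periodic hr ho hy]
    obtain ⟨i, rfl⟩ := ho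
    have hsub : (∫ x in (0 : ℝ)..y, f x) - (i + 1 : ℤ) * (2 * ((2 : ℝ) ^ n)⁻¹)
        = -∫ x in y..(((2 * i + 1 : ℤ) + 1) * ((2 : ℝ) ^ n)⁻¹), f x := by
      rw [← hprim]; push_cast at hcell ⊢; linear_combination hcell
    have habs := congrArg abs hsub
    rw [abs_neg, abs_of_nonneg hright] at habs
    rw [AddCircle.norm_coe_of_abs_sub_le hh (i + 1) (by rw [habs]; linarith), habs]

end IsMeanOne

lemma two_pow_succ_dvd_sub_factorization {k : ℕ} (hk : k ≠ 0) :
    2 ^ (k.factorization 2 + 1) ∣ k - 2 ^ k.factorization 2 := by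
  obtain ⟨m, hm⟩ := Nat.ordProj_dvd k 2
  have hodd : ¬ 2 ∣ m := fun ⟨j, hj⟩ =>
    Nat.pow_succ_factorization_not_dvd hk Nat.prime_two
      ⟨j, by rw [hj, ← mul_assoc, ← pow_succ] at hm; exact hm⟩
  obtain ⟨j, rfl⟩ : ∃ j, m = 2 * j + 1 := ⟨m / 2, by omega⟩
  refine ⟨j, ?_⟩
  generalize k.factorization 2 = a at *
  rw [pow_succ]
  exact Nat.sub_eq_of_eq_add (by linarith)

lemma exists_isMeanOne_eqOn_Wfun (k : ℕ) : ∀ n, 2 ^ n ∣ k → ∃ G, IsMeanOne n G ∧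
    Set.EqOn (Wfun k) G (Set.Ico 0 1) ∧ (k ≠ 0 → ∃ x ∈ Set.Ioo (0 : ℝ) 1, G x = 2) := by
  induction k using Nat.strong_induction_on with
  | _ k ih =>
    intro n hn
    rcases k with _ | k
    · refine ⟨fun _ => 1, ⟨continuous_const, fun _ => rfl, fun _ => zero_le_one,
        fun _ => one_le_two, by simp⟩, fun x _ => by rw [Wfun], fun h => (h rfl).elim⟩
    · obtain ⟨f, hf, hWf, -⟩ := ih _ (Nat.sub_lt (Nat.succ_pos k) (Nat.two_pow_pos _)) _
        (two_pow_succ_dvd_sub_factorization k.succ_ne_zero)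
      refine ⟨primitiveTent _ f, hf.primitiveTent.mono
        ((Nat.prime_two.pow_dvd_iff_le_factorization k.succ_ne_zero).mp hn), fun y hy => ?_,
        fun _ => ⟨_, ⟨by positivity, inv_lt_one_of_one_lt₀ (one_lt_pow₀ one_lt_two
          (Nat.succ_ne_zero _))⟩, hf.primitiveTent_half⟩⟩
      rw [← hf.integral_chi_mul (Nat.le_add_left _ _) hy, Wfun]
      exact setIntegral_congr_fun measurableSet_Ico fun x hx => by simp only [hWf hx]

lemma enorm_le_eLpNormEssSup_of_continuous {G : ℝ → ℝ} (hG : Continuous G) {U : Set ℝ}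
    (hU : IsOpen U) {x : ℝ} (hx : x ∈ U) : ‖G x‖ₑ ≤ eLpNormEssSup G (volume.restrict U) := by
  by_contra! hlt
  have hopen : IsOpen ({z | eLpNormEssSup G (volume.restrict U) < ‖G z‖ₑ} ∩ U) :=
    (isOpen_lt continuous_const hG.enorm).inter hU
  refine (hopen.measure_pos volume ⟨x, hlt, hx⟩).ne' ?_
  have hae : ∀ᵐ y ∂(volume.restrict U), ‖G y‖ₑ ≤ eLpNormEssSup G (volume.restrict U) :=
    ae_le_eLpNormEssSup
  rw [ae_restrict_iff' hU.measurableSet, ae_iff] at hae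
  refine measure_mono_null (fun z hz => ?_) hae
  simpa using ⟨hz.2, hz.1⟩

/-- `sup_{x ∈ [0,1)} W(k)(x) = 2`, and in particular
`‖W(k)‖_{L^∞([0,1))} = 2`. -/
theorem stmt16 (k : ℕ) (hk : 1 ≤ k) :
    sSup (Wfun k '' Set.Ico (0 : ℝ) 1) = 2 ∧
      eLpNorm (Wfun k) ∞ (volume.restrict (Set.Ico (0 : ℝ) 1)) = 2 := by
  obtain ⟨G, hG, hWG, hmax⟩ := exists_isMeanOne_eqOn_Wfun k 0 (by simp)
  obtain ⟨x, hx, hGx⟩ := hmax (by omega)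
  constructor
  · rw [hWG.image_eq]
    refine IsGreatest.csSup_eq ⟨⟨x, Set.Ioo_subset_Ico_self hx, hGx⟩, ?_⟩
    rintro _ ⟨z, -, rfl⟩
    exact hG.le_two z
  · have hae : Wfun k =ᵐ[volume.restrict (Set.Ico (0 : ℝ) 1)] G :=
      (ae_restrict_iff' measurableSet_Ico).mpr (.of_forall hWG)
    rw [eLpNorm_congr_ae hae, eLpNorm_exponent_top]
    apply le_antisymm
    · refine (eLpNormEssSup_le_of_ae_bound (C := 2) (.of_forall fun z => ?_)).trans (by simp)
      rw [Real.norm_of_nonneg (hG.nonneg z)]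
      exact hG.le_two z
    · rw [← restrict_Ioo_eq_restrict_Ico]
      refine le_trans ?_ (enorm_le_eLpNormEssSup_of_continuous hG.continuous isOpen_Ioo hx)
      rw [hGx, Real.enorm_eq_ofReal zero_le_two]
      simp

end
end

section
/- Let s ≥ 1, let f : [0,1]^s → ℝ be C^∞, and let k ∈ ℕ₀^s, where k_i has N_i nonzero binary digits. If the mixed partial derivative f^{(N₁,…,N_s)} = ∂^{N₁+⋯+N_s} f / ∂x₁^{N₁}⋯∂x_s^{N_s} is nonnegative on [0,1]^s, then (−1)^{N₁+⋯+N_s} · f̂(k) ≥ 0. -/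
open MeasureTheory Finset
open scoped ENNReal

noncomputable section

/-! ### Flipping binary digits -/

theorem bdigit_zero_or_one (x : ℝ) (n : ℕ) : bdigit x n = 0 ∨ bdigit x n = 1 :=
  Nat.mod_two_eq_zero_or_one _

theorem measurable_bdigit (n : ℕ) : Measurable fun x => bdigit x n := by
  have h : Measurable fun z : ℤ => z.toNat % 2 := measurable_of_countable _
  exact h.comp (Int.measurable_floor.comp (measurable_id.mul_const _))

theorem bdigit_eq_natFloor_mod {x : ℝ} (n : ℕ) : bdigit x n = ⌊x * 2 ^ n⌋₊ % 2 := rfl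

theorem natFloor_add_inv_two_pow {x : ℝ} (hx : 0 ≤ x) (n d : ℕ) :
    ⌊(x + (2 ^ n)⁻¹) * 2 ^ (n + d)⌋₊ = ⌊x * 2 ^ (n + d)⌋₊ + 2 ^ d := by
  have h : (x + (2 ^ n)⁻¹) * 2 ^ (n + d) = x * 2 ^ (n + d) + ((2 ^ d : ℕ) : ℝ) := by
    push_cast
    rw [pow_add]
    field_simp
  rw [h, Nat.floor_add_natCast (by positivity)]

theorem natFloor_mul_two_pow (x : ℝ) (m d : ℕ) :
    ⌊x * 2 ^ m⌋₊ = ⌊x * 2 ^ (m + d)⌋₊ / 2 ^ d := by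
  rw [← Nat.floor_div_natCast]
  congr 1
  push_cast
  rw [pow_add]
  field_simp

theorem bdigit_add_self {x : ℝ} {n : ℕ} (hx : 0 ≤ x) (h : bdigit x n = 0) :
    bdigit (x + (2 ^ n)⁻¹) n = 1 := by
  have := natFloor_add_inv_two_pow hx n 0
  rw [bdigit_eq_natFloor_mod] at *
  simp only [add_zero, pow_zero] at this
  omega

theorem natFloor_add_of_lt {x : ℝ} {m n : ℕ} (hx : 0 ≤ x) (h : bdigit x n = 0) (hmn : m < n) :
    ⌊(x + (2 ^ n)⁻¹) * 2 ^ m⌋₊ = ⌊x * 2 ^ m⌋₊ := by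
  obtain ⟨d, rfl⟩ := Nat.exists_eq_add_of_lt hmn
  have e := natFloor_add_inv_two_pow hx (m + d + 1) 0
  rw [bdigit_eq_natFloor_mod] at h
  simp only [add_zero, pow_zero] at e
  rw [natFloor_mul_two_pow _ m (d + 1), natFloor_mul_two_pow x m (d + 1), ← add_assoc, e,
    pow_succ' 2 d, ← Nat.div_div_eq_div_mul, ← Nat.div_div_eq_div_mul]
  congr 1
  omega

theorem bdigit_add_of_ne {x : ℝ} {m n : ℕ} (hx : 0 ≤ x) (h : bdigit x n = 0) (hmn : m ≠ n) :
    bdigit (x + (2 ^ n)⁻¹) m = bdigit x m := by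
  rcases lt_or_gt_of_ne hmn with hlt | hgt
  · rw [bdigit_eq_natFloor_mod, bdigit_eq_natFloor_mod, natFloor_add_of_lt hx h hlt]
  · obtain ⟨d, rfl⟩ := Nat.exists_eq_add_of_lt hgt
    rw [bdigit_eq_natFloor_mod, bdigit_eq_natFloor_mod, add_assoc, natFloor_add_inv_two_pow hx, pow_succ]
    omega

theorem add_inv_two_pow_mem_Ico {x : ℝ} {n : ℕ} (hn : 0 < n) (hx : x ∈ Set.Ico (0 : ℝ) 1)
    (h : bdigit x n = 0) : x + (2 ^ n)⁻¹ ∈ Set.Ico (0 : ℝ) 1 := by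
  have e := natFloor_add_of_lt hx.1 h hn
  have hx0 : ⌊x⌋₊ = 0 := Nat.floor_eq_zero.2 hx.2
  simp only [pow_zero, mul_one, hx0] at e
  exact ⟨add_nonneg hx.1 (by positivity), Nat.floor_eq_zero.1 e⟩

theorem inv_two_pow_le_of_bdigit_eq_one {x : ℝ} {n : ℕ} (h : bdigit x n = 1) :
    (2 ^ n)⁻¹ ≤ x := by
  rw [bdigit_eq_natFloor_mod] at h
  have h1 : 1 ≤ ⌊x * 2 ^ n⌋₊ := by
    by_contra hc
    have : ⌊x * 2 ^ n⌋₊ = 0 := by omega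
    simp [this] at h
  have h2 : (1 : ℝ) ≤ x * 2 ^ n := Nat.floor_pos.1 h1
  rw [inv_le_iff_one_le_mul₀ (by positivity)]
  linarith

theorem bdigit_sub_self {x : ℝ} {n : ℕ} (h : bdigit x n = 1) :
    bdigit (x - (2 ^ n)⁻¹) n = 0 := by
  have hle := inv_two_pow_le_of_bdigit_eq_one h
  have e := natFloor_add_inv_two_pow (sub_nonneg.2 hle) n 0
  rw [bdigit_eq_natFloor_mod] at *
  simp only [sub_add_cancel, add_zero, pow_zero] at e
  omega

/-! ### The shifts `x ↦ x + 2^{-(j+1)} e_i` and the associated digits -/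

section

variable {s : ℕ}

/-- The digit of position `p.2 + 1` of the coordinate `p.1`. -/
def coordDigit (p : Σ _ : Fin s, ℕ) (x : Fin s → ℝ) : ℕ := bdigit (x p.1) (p.2 + 1)

/-- The vector `2^{-(p.2+1)} e_{p.1}`. -/
def coordStep (p : Σ _ : Fin s, ℕ) : Fin s → ℝ := Pi.single p.1 (2 ^ (p.2 + 1))⁻¹

theorem coordStep_nonneg (p : Σ _ : Fin s, ℕ) : 0 ≤ coordStep p :=
  Pi.single_nonneg.2 (by positivity)

theorem measurable_coordDigit (p : Σ _ : Fin s, ℕ) : Measurable (coordDigit p) :=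
  (measurable_bdigit _).comp (measurable_pi_apply _)

theorem nonneg_of_mem_unitCube {x : Fin s → ℝ} (hx : x ∈ unitCube s) (i : Fin s) : 0 ≤ x i :=
  (hx i trivial).1

theorem coordDigit_add_self {p : Σ _ : Fin s, ℕ} {x : Fin s → ℝ} (hx : x ∈ unitCube s)
    (h : coordDigit p x = 0) : coordDigit p (x + coordStep p) = 1 := by
  simpa [coordDigit, coordStep] using bdigit_add_self (nonneg_of_mem_unitCube hx p.1) h

theorem coordDigit_add_of_ne {p q : Σ _ : Fin s, ℕ} {x : Fin s → ℝ} (hx : x ∈ unitCube s)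
    (h : coordDigit p x = 0) (hpq : q ≠ p) :
    coordDigit q (x + coordStep p) = coordDigit q x := by
  obtain ⟨i, m⟩ := q
  obtain ⟨j, n⟩ := p
  by_cases hij : i = j
  · subst hij
    have hmn : m + 1 ≠ n + 1 := by
      rintro hmn
      exact hpq (by rw [Nat.succ_injective hmn])
    simpa [coordDigit, coordStep] using bdigit_add_of_ne (nonneg_of_mem_unitCube hx i) h hmn
  · simp [coordDigit, coordStep, Pi.single_eq_of_ne hij]

theorem add_coordStep_mem_unitCube {p : Σ _ : Fin s, ℕ} {x : Fin s → ℝ} (hx : x ∈ unitCube s)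
    (h : coordDigit p x = 0) : x + coordStep p ∈ unitCube s := by
  intro i _
  by_cases hi : i = p.1
  · subst hi
    simpa [coordStep] using add_inv_two_pow_mem_Ico (Nat.succ_pos _) (hx p.1 trivial) h
  · simpa [coordStep, Pi.single_eq_of_ne hi] using hx i trivial

theorem coordDigit_sub_self {p : Σ _ : Fin s, ℕ} {x : Fin s → ℝ}
    (h : coordDigit p x = 1) : coordDigit p (x - coordStep p) = 0 := by
  simpa [coordDigit, coordStep] using bdigit_sub_self h

theorem sub_coordStep_mem_unitCube {p : Σ _ : Fin s, ℕ} {x : Fin s → ℝ} (hx : x ∈ unitCube s)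
    (h : coordDigit p x = 1) : x - coordStep p ∈ unitCube s := by
  intro i _
  by_cases hi : i = p.1
  · subst hi
    have h1 := inv_two_pow_le_of_bdigit_eq_one h
    have h2 := (hx p.1 trivial).2
    have h3 : (0 : ℝ) < (2 ^ (p.2 + 1))⁻¹ := by positivity
    simp only [coordStep, Pi.sub_apply, Pi.single_eq_same]
    exact ⟨by linarith, by linarith⟩
  · simpa [coordStep, Pi.single_eq_of_ne hi] using hx i trivial

theorem coordDigit_sub_of_ne {p q : Σ _ : Fin s, ℕ} {x : Fin s → ℝ} (hx : x ∈ unitCube s)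
    (h : coordDigit p x = 1) (hpq : q ≠ p) :
    coordDigit q (x - coordStep p) = coordDigit q x := by
  have := coordDigit_add_of_ne (sub_coordStep_mem_unitCube hx h) (coordDigit_sub_self h) hpq
  rw [sub_add_cancel] at this
  exact this.symm

theorem add_sum_coordStep_mem_unitCube {L : List (Σ _ : Fin s, ℕ)} (hL : L.Nodup)
    {x : Fin s → ℝ} (hx : x ∈ unitCube s) (h : ∀ p ∈ L, coordDigit p x = 0) :
    x + (L.map coordStep).sum ∈ unitCube s := by
  induction L generalizing x with
  | nil => simpa using hx
  | cons p L ih =>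
    rw [List.nodup_cons] at hL
    have hp := h p List.mem_cons_self
    rw [List.map_cons, List.sum_cons, ← add_assoc]
    refine ih hL.2 (add_coordStep_mem_unitCube hx hp) fun q hq => ?_
    rw [coordDigit_add_of_ne hx hp (fun e => hL.1 (e ▸ hq))]
    exact h q (List.mem_cons_of_mem _ hq)

/-! ### Iterated differences -/

/-- The forward difference of `F` with step `coordStep p`. -/
def coordDiff (p : Σ _ : Fin s, ℕ) (F : (Fin s → ℝ) → ℝ) (x : Fin s → ℝ) : ℝ :=
  F (x + coordStep p) - F x

/-- The composition of the forward differences along a list. -/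
def iterDiff : List (Σ _ : Fin s, ℕ) → ((Fin s → ℝ) → ℝ) → (Fin s → ℝ) → ℝ
  | [], F => F
  | p :: L, F => iterDiff L (coordDiff p F)

theorem coordDiff_comm (p q : Σ _ : Fin s, ℕ) (F : (Fin s → ℝ) → ℝ) :
    coordDiff p (coordDiff q F) = coordDiff q (coordDiff p F) := by
  funext x
  simp only [coordDiff, add_right_comm x (coordStep p)]
  ring

theorem iterDiff_coordDiff (L : List (Σ _ : Fin s, ℕ)) (p : Σ _ : Fin s, ℕ)
    (F : (Fin s → ℝ) → ℝ) : iterDiff L (coordDiff p F) = coordDiff p (iterDiff L F) := by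
  induction L generalizing F with
  | nil => rfl
  | cons q L ih => simp only [iterDiff, coordDiff_comm q p, ih]

theorem mem_closedCube_iff {x : Fin s → ℝ} : x ∈ closedCube s ↔ 0 ≤ x ∧ x ≤ 1 := by
  simp [closedCube, Pi.le_def]

theorem mem_closedCube_of_le {x y z : Fin s → ℝ} (hx : x ∈ closedCube s) (hz : z ∈ closedCube s)
    (hxy : x ≤ y) (hyz : y ≤ z) : y ∈ closedCube s := by
  rw [mem_closedCube_iff] at *
  exact ⟨hx.1.trans hxy, hyz.trans hz.2⟩

theorem sum_coordStep_nonneg (L : List (Σ _ : Fin s, ℕ)) : 0 ≤ (L.map coordStep).sum := by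
  apply List.sum_nonneg
  simp only [List.mem_map]
  rintro _ ⟨p, -, rfl⟩
  exact coordStep_nonneg p

/-- If `G` has directional derivative `G'` in direction `i` on the closed cube, then iterated
differences of `G` have the iterated differences of `G'` as derivative. -/
theorem hasDerivWithinAt_iterDiff {i : Fin s} {G G' : (Fin s → ℝ) → ℝ}
    (hG : ∀ x ∈ closedCube s,
      HasDerivWithinAt (fun t => G (Function.update x i t)) (G' x) (Set.Icc 0 1) (x i))
    (L : List (Σ _ : Fin s, ℕ)) {h : ℝ} {x : Fin s → ℝ} (hx : x ∈ closedCube s)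
    (hxh : x + Pi.single i h + (L.map coordStep).sum ∈ closedCube s)
    {t : ℝ} (ht : t ∈ Set.Icc 0 h) :
    HasDerivWithinAt (fun t => iterDiff L G (x + Pi.single i t))
      (iterDiff L G' (x + Pi.single i t)) (Set.Icc 0 h) t := by
  induction L generalizing x with
  | nil =>
    simp only [List.map_nil, List.sum_nil, add_zero] at hxh
    have hle {a b : ℝ} (hab : a ≤ b) :
        (Pi.single i a : Fin s → ℝ) ≤ Pi.single i b := Pi.single_mono i hab
    have hmem {r : ℝ} (hr : r ∈ Set.Icc 0 h) : x + Pi.single i r ∈ closedCube s := by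
      refine mem_closedCube_of_le hx hxh (le_add_of_nonneg_right (Pi.single_nonneg.2 hr.1)) ?_
      exact add_le_add_right (hle hr.2) x
    have hd := hG _ (hmem ht)
    have hshift : HasDerivWithinAt (fun r => x i + r) 1 (Set.Icc 0 h) t :=
      ((hasDerivAt_id t).const_add (x i)).hasDerivWithinAt
    have hmaps : Set.MapsTo (fun r => x i + r) (Set.Icc 0 h) (Set.Icc 0 1) := fun r hr => by
      simpa using hmem hr i trivial
    have hval : (x + Pi.single i t : Fin s → ℝ) i = x i + t := by simp
    rw [hval] at hd
    have hcomp := HasDerivWithinAt.comp t hd hshift hmaps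
    rw [mul_one] at hcomp
    refine hcomp.congr_of_mem (fun r _ => ?_) ht
    simp only [iterDiff, Function.comp_apply]
    congr 1
    ext j
    by_cases hj : j = i
    · subst hj; simp
    · simp [hj]
  | cons p L ih =>
    simp only [iterDiff, iterDiff_coordDiff]
    rw [List.map_cons, List.sum_cons] at hxh
    have hp := coordStep_nonneg p
    have hs0 := sum_coordStep_nonneg L
    have hh : (0 : Fin s → ℝ) ≤ Pi.single i h := Pi.single_nonneg.2 (ht.1.trans ht.2)
    have h1 : x + coordStep p ∈ closedCube s := by
      refine mem_closedCube_of_le hx hxh (le_add_of_nonneg_right hp) fun j => ?_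
      have := hp j; have := hs0 j; have := hh j
      simp only [Pi.add_apply, Pi.zero_apply] at *
      linarith
    have h2 : x + Pi.single i h + (L.map coordStep).sum ∈ closedCube s := by
      refine mem_closedCube_of_le hx hxh (fun j => ?_) fun j => ?_
      all_goals
        have := hp j; have := hs0 j; have := hh j
        simp only [Pi.add_apply, Pi.zero_apply] at *
        linarith
    have d1 := ih h1 (by convert hxh using 1; abel)
    have d2 := ih hx h2
    have d := d1.sub d2
    simp only [add_right_comm x (coordStep p)] at d
    exact d

theorem addE_eq (i : Fin s) (ν : Fin s → ℕ) : addE i ν = ν + Pi.single i 1 := by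
  ext j
  by_cases hj : j = i
  · subst hj; simp [addE]
  · simp [addE, hj]

theorem iterDiff_nonneg {D : (Fin s → ℕ) → (Fin s → ℝ) → ℝ}
    (hD : ∀ ν i, ∀ x ∈ closedCube s,
      HasDerivWithinAt (fun t => D ν (Function.update x i t)) (D (addE i ν) x)
        (Set.Icc 0 1) (x i))
    (L : List (Σ _ : Fin s, ℕ)) (ν : Fin s → ℕ)
    (hpos : ∀ x ∈ closedCube s, 0 ≤ D (ν + (L.map fun p => Pi.single p.1 1).sum) x)
    {x : Fin s → ℝ} (hx : x ∈ closedCube s) (hxL : x + (L.map coordStep).sum ∈ closedCube s) :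
    0 ≤ iterDiff L (D ν) x := by
  induction L generalizing ν x with
  | nil => simpa [iterDiff] using hpos x hx
  | cons p L ih =>
    rw [List.map_cons, List.sum_cons, ← add_assoc] at hxL
    set h : ℝ := (2 ^ (p.2 + 1))⁻¹ with hh
    have hh0 : 0 ≤ h := by positivity
    have hder : ∀ t ∈ Set.Icc 0 h, HasDerivWithinAt (fun t => iterDiff L (D ν) (x + Pi.single p.1 t))
        (iterDiff L (D (addE p.1 ν)) (x + Pi.single p.1 t)) (Set.Icc 0 h) t := fun t ht =>
      hasDerivWithinAt_iterDiff (hD ν p.1) L hx hxL ht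
    have hmono : MonotoneOn (fun t => iterDiff L (D ν) (x + Pi.single p.1 t)) (Set.Icc 0 h) := by
      refine monotoneOn_of_hasDerivWithinAt_nonneg
        (f' := fun t => iterDiff L (D (addE p.1 ν)) (x + Pi.single p.1 t)) (convex_Icc 0 h)
        (fun t ht => (hder t ht).continuousWithinAt)
        (fun t ht => (hder t (interior_subset ht)).mono interior_subset) fun t ht => ?_
      have ht := interior_subset ht
      have hs0 := sum_coordStep_nonneg L
      have h0 : (0 : Fin s → ℝ) ≤ Pi.single p.1 t := Pi.single_nonneg.2 ht.1
      have h1 : (Pi.single p.1 t : Fin s → ℝ) ≤ coordStep p := Pi.single_mono p.1 ht.2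
      refine ih _ (by simpa [addE_eq, add_assoc] using hpos) ?_ ?_
      all_goals
        refine mem_closedCube_of_le hx hxL (fun j => ?_) fun j => ?_
        all_goals
          have := hs0 j; have := h0 j; have := h1 j
          simp only [Pi.add_apply, Pi.zero_apply] at *
          linarith
    have := hmono (Set.left_mem_Icc.2 hh0) (Set.right_mem_Icc.2 hh0) hh0
    simp only [iterDiff, iterDiff_coordDiff, coordDiff]
    simpa [coordStep] using this

/-! ### Folding the Walsh integral -/

/-- The product of the signs `(-1)^{ξ}` over the digits `ξ` of `x` listed in `L`. -/
def digitSign (L : List (Σ _ : Fin s, ℕ)) (x : Fin s → ℝ) : ℝ :=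
  (L.map fun p => (-1 : ℝ) ^ coordDigit p x).prod

theorem measurable_digitSign (L : List (Σ _ : Fin s, ℕ)) : Measurable (digitSign L) := by
  induction L with
  | nil => exact measurable_const
  | cons p L ih =>
    have h : Measurable fun n : ℕ => (-1 : ℝ) ^ n := measurable_of_countable _
    exact (h.comp (measurable_coordDigit p)).mul ih

theorem norm_digitSign (L : List (Σ _ : Fin s, ℕ)) (x : Fin s → ℝ) : ‖digitSign L x‖ = 1 := by
  induction L with
  | nil => simp [digitSign]
  | cons p L ih =>
    simp only [digitSign, List.map_cons, List.prod_cons, norm_mul] at *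
    simp [ih]

theorem digitSign_add {L : List (Σ _ : Fin s, ℕ)} {p : Σ _ : Fin s, ℕ} (hp : p ∉ L)
    {x : Fin s → ℝ} (hx : x ∈ unitCube s) (h : coordDigit p x = 0) :
    digitSign L (x + coordStep p) = digitSign L x := by
  unfold digitSign
  congr 1
  refine List.map_congr_left fun q hq => ?_
  rw [coordDigit_add_of_ne hx h (fun e => hp (e ▸ hq))]

/-- `A` is invariant under flipping the digit `p`. -/
def FlipInvariant (p : Σ _ : Fin s, ℕ) (A : Set (Fin s → ℝ)) : Prop :=
  ∀ x ∈ A, (coordDigit p x = 0 → x + coordStep p ∈ A) ∧ (coordDigit p x = 1 → x - coordStep p ∈ A)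

theorem preimage_add_coordStep {p : Σ _ : Fin s, ℕ} {A : Set (Fin s → ℝ)} (hA : A ⊆ unitCube s)
    (hp : FlipInvariant p A) :
    (fun x => x + coordStep p) ⁻¹' (A \ {x | coordDigit p x = 0}) =
      A ∩ {x | coordDigit p x = 0} := by
  ext x
  simp only [Set.mem_preimage, Set.mem_sdiff, Set.mem_ofPred_eq, Set.mem_inter_iff]
  constructor
  · rintro ⟨hx, h⟩
    have h1 := (bdigit_zero_or_one _ _).resolve_left h
    have hm := (hp _ hx).2 h1
    have hd := coordDigit_sub_self h1
    rw [add_sub_cancel_right] at hm hd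
    exact ⟨hm, hd⟩
  · rintro ⟨hx, h⟩
    exact ⟨(hp x hx).1 h, by simp [coordDigit_add_self (hA hx) h]⟩

theorem integrableOn_comp_add_coordStep {p : Σ _ : Fin s, ℕ} {A : Set (Fin s → ℝ)}
    (hA : A ⊆ unitCube s) (hp : FlipInvariant p A) {G : (Fin s → ℝ) → ℝ}
    (hG : IntegrableOn G A) :
    IntegrableOn (fun x => G (x + coordStep p)) (A ∩ {x | coordDigit p x = 0}) := by
  rw [← preimage_add_coordStep hA hp]
  exact ((measurePreserving_add_right volume (coordStep p)).integrableOn_comp_preimage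
    (MeasurableEquiv.addRight (coordStep p)).measurableEmbedding).2 (hG.mono_set Set.sdiff_subset)

theorem setIntegral_eq_fold {p : Σ _ : Fin s, ℕ} {A : Set (Fin s → ℝ)}
    (hA : A ⊆ unitCube s) (hp : FlipInvariant p A) {G : (Fin s → ℝ) → ℝ}
    (hG : IntegrableOn G A) :
    ∫ x in A, G x = ∫ x in A ∩ {x | coordDigit p x = 0}, (G x + G (x + coordStep p)) := by
  have hZ : MeasurableSet {x : Fin s → ℝ | coordDigit p x = 0} :=
    measurable_coordDigit p (measurableSet_singleton 0)
  rw [← integral_inter_add_sdiff hZ hG, integral_add (hG.mono_set Set.inter_subset_left)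
    (integrableOn_comp_add_coordStep hA hp hG)]
  congr 1
  rw [← preimage_add_coordStep hA hp]
  exact ((measurePreserving_add_right volume (coordStep p)).setIntegral_preimage_emb
    (MeasurableEquiv.addRight (coordStep p)).measurableEmbedding _ _).symm

theorem FlipInvariant.inter_digit_eq_zero {p q : Σ _ : Fin s, ℕ} {A : Set (Fin s → ℝ)}
    (hA : A ⊆ unitCube s) (hq : FlipInvariant q A) (hpq : p ≠ q) :
    FlipInvariant q (A ∩ {x | coordDigit p x = 0}) := by
  rintro x ⟨hx, h⟩
  refine ⟨fun h0 => ⟨(hq x hx).1 h0, ?_⟩, fun h1 => ⟨(hq x hx).2 h1, ?_⟩⟩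
  · exact (coordDigit_add_of_ne (hA hx) h0 hpq).trans h
  · exact (coordDigit_sub_of_ne (hA hx) h1 hpq).trans h

theorem integrableOn_mul_digitSign {A : Set (Fin s → ℝ)} {F : (Fin s → ℝ) → ℝ}
    (hF : IntegrableOn F A) (L : List (Σ _ : Fin s, ℕ)) :
    IntegrableOn (fun x => F x * digitSign L x) A :=
  Integrable.mul_bdd (c := 1) hF (measurable_digitSign L).aestronglyMeasurable
    (Filter.Eventually.of_forall fun x => (norm_digitSign L x).le)

theorem setIntegral_mul_digitSign_nonneg {L : List (Σ _ : Fin s, ℕ)} (hL : L.Nodup)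
    {A : Set (Fin s → ℝ)} (hAm : MeasurableSet A) (hA : A ⊆ unitCube s)
    (hinv : ∀ p ∈ L, FlipInvariant p A) {F : (Fin s → ℝ) → ℝ} (hF : IntegrableOn F A)
    (hpos : ∀ x ∈ A, (∀ p ∈ L, coordDigit p x = 0) → 0 ≤ iterDiff L F x) :
    0 ≤ (-1 : ℝ) ^ L.length * ∫ x in A, F x * digitSign L x := by
  induction L generalizing A F with
  | nil =>
    simp only [List.length_nil, pow_zero, one_mul, digitSign, List.map_nil, List.prod_nil, mul_one]
    exact setIntegral_nonneg hAm fun x hx => hpos x hx (by simp)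
  | cons p L ih =>
    rw [List.nodup_cons] at hL
    have hp := hinv p List.mem_cons_self
    have hm : MeasurableSet (A ∩ {x | coordDigit p x = 0}) :=
      hAm.inter (measurable_coordDigit p (measurableSet_singleton 0))
    have key := ih hL.2 hm (Set.inter_subset_left.trans hA)
      (fun q hq => (hinv q (List.mem_cons_of_mem _ hq)).inter_digit_eq_zero hA
        (fun e => hL.1 (e ▸ hq)))
      (F := coordDiff p F)
      ((integrableOn_comp_add_coordStep hA hp hF).sub (hF.mono_set Set.inter_subset_left))
      (fun x hx h => hpos x hx.1 (by
        intro q hq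
        rcases List.mem_cons.1 hq with rfl | hq
        · exact hx.2
        · exact h q hq))
    rw [setIntegral_eq_fold hA hp (integrableOn_mul_digitSign hF _), List.length_cons, pow_succ,
      mul_assoc, neg_one_mul, ← integral_neg]
    refine key.trans_eq ?_
    congr 1
    refine setIntegral_congr_fun hm fun x hx => ?_
    have h0 : coordDigit p x = 0 := hx.2
    have hs := digitSign_add hL.1 (hA hx.1) h0
    simp only [digitSign] at hs
    simp only [digitSign, List.map_cons, List.prod_cons, hs, h0,
      coordDigit_add_self (hA hx.1) h0, coordDiff]
    ring

/-! ### Walsh functions -/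

/-- The positions of the nonzero binary digits of the components of `k`. -/
def bitPositions (k : Fin s → ℕ) : Finset (Σ _ : Fin s, ℕ) :=
  Finset.univ.sigma fun i => (Finset.range (k i)).filter fun j => (k i).testBit j

theorem numBits_eq_card (k : ℕ) :
    numBits k = ((Finset.range k).filter fun j => k.testBit j).card := by
  simp [numBits, bitsDesc, Finset.card, Finset.filter, Finset.range, Multiset.range]

theorem walshV_eq_digitSign (k : Fin s → ℕ) (x : Fin s → ℝ) :
    walshV k x = digitSign (bitPositions k).toList x := by
  rw [digitSign, Finset.prod_map_toList, bitPositions, Finset.prod_sigma, walshV]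
  refine Finset.prod_congr rfl fun i _ => ?_
  rw [walsh, ← Finset.sum_filter, Finset.prod_pow_eq_pow_sum]
  rfl

theorem length_bitPositions (k : Fin s → ℕ) :
    (bitPositions k).toList.length = ∑ i, numBits (k i) := by
  simp [bitPositions, numBits_eq_card]

theorem sum_single_bitPositions (k : Fin s → ℕ) :
    ((bitPositions k).toList.map fun p => (Pi.single p.1 1 : Fin s → ℕ)).sum =
      fun i => numBits (k i) := by
  rw [Finset.sum_map_toList, bitPositions, Finset.sum_sigma]
  ext i
  simp [numBits_eq_card, Finset.sum_apply, Pi.single_apply]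

theorem unitCube_subset_closedCube : unitCube s ⊆ closedCube s :=
  Set.pi_mono fun _ _ => Set.Ico_subset_Icc_self

theorem isCompact_closedCube : IsCompact (closedCube s) :=
  isCompact_univ_pi fun _ => isCompact_Icc

theorem measurableSet_unitCube : MeasurableSet (unitCube s) :=
  MeasurableSet.univ_pi fun _ => measurableSet_Ico

theorem flipInvariant_unitCube (p : Σ _ : Fin s, ℕ) : FlipInvariant p (unitCube s) :=
  fun _ hx => ⟨add_coordStep_mem_unitCube hx, sub_coordStep_mem_unitCube hx⟩

end

/-- Corollary: if `f` is `C^∞` on `[0,1]^s` (i.e. has continuous mixed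
partial derivatives `D ν` of all orders) and `f^{(N₁,…,N_s)} ≥ 0` on `[0,1]^s`, then
`(-1)^{N₁+⋯+N_s} ⋅ f̂(k) ≥ 0`. -/
theorem stmt17 {s : ℕ} (hs : 1 ≤ s) (f : (Fin s → ℝ) → ℝ)
    (D : (Fin s → ℕ) → (Fin s → ℝ) → ℝ)
    (hf : ∀ u : Fin s → ℕ, HasMixedDerivs u f D)
    (k : Fin s → ℕ)
    (hpos : ∀ x ∈ closedCube s, 0 ≤ D (fun i => numBits (k i)) x) :
    0 ≤ (-1 : ℝ) ^ (∑ i, numBits (k i)) * walshCoeff f k := by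
  have hD : ∀ ν i, ∀ x ∈ closedCube s,
      HasDerivWithinAt (fun t => D ν (Function.update x i t)) (D (addE i ν) x)
        (Set.Icc 0 1) (x i) := fun ν i => (hf (addE i ν)).2.2 ν i fun _ => le_rfl
  have h0 : D 0 = f := (hf 0).1
  have hint : IntegrableOn f (unitCube s) := by
    rw [← h0]
    exact (((hf 0).2.1 0 fun _ => le_rfl).integrableOn_compact isCompact_closedCube).mono_set
      unitCube_subset_closedCube
  simp only [walshCoeff, walshV_eq_digitSign, ← length_bitPositions]
  refine setIntegral_mul_digitSign_nonneg (bitPositions k).nodup_toList measurableSet_unitCube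
    subset_rfl (fun p _ => flipInvariant_unitCube p) hint fun x hx hdig => ?_
  rw [← h0]
  refine iterDiff_nonneg hD _ 0 ?_ (unitCube_subset_closedCube hx)
    (unitCube_subset_closedCube
      (add_sum_coordStep_mem_unitCube (bitPositions k).nodup_toList hx hdig))
  rw [sum_single_bitPositions, zero_add]
  exact hpos

end
end

section
/- The series ∑_{k=1}^∞ 2^{−μ'₂(k)} converges, and 1 + ∑_{k=1}^∞ 2^{−μ'₂(k)} = 3/2 + ∑_{l=0}^∞ l · 2^{−l−4}. -/
open MeasureTheory Finset
open scoped ENNReal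

noncomputable section

theorem filter_testBit_range_eq {k m n : ℕ} (hk : k < 2 ^ m) (hmn : m ≤ n) :
    (List.range n).filter (fun j => k.testBit j) =
      (List.range m).filter (fun j => k.testBit j) := by
  induction n, hmn using Nat.le_induction with
  | base => rfl
  | succ n hmn ih =>
    have hn : k.testBit n = false :=
      Nat.testBit_lt_two_pow (hk.trans_le (Nat.pow_le_pow_right two_pos hmn))
    simp [List.range_succ, List.filter_append, ih, hn]

theorem bitsDesc_eq_of_lt {k m : ℕ} (hk : k < 2 ^ m) :
    bitsDesc k = ((List.range m).filter fun j => k.testBit j).reverse := by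
  rw [bitsDesc, ← filter_testBit_range_eq Nat.lt_two_pow_self (le_max_left k m),
    filter_testBit_range_eq hk (le_max_right k m)]

theorem bitsDesc_two_pow_add {a r : ℕ} (hr : r < 2 ^ a) :
    bitsDesc (2 ^ a + r) = a :: bitsDesc r := by
  have hlt : 2 ^ a + r < 2 ^ (a + 1) := by rw [pow_succ]; omega
  have htop : (2 ^ a + r).testBit a = true := by
    rw [Nat.testBit_two_pow_add_eq, Nat.testBit_lt_two_pow hr]; rfl
  have hlow : (List.range a).filter (fun j => (2 ^ a + r).testBit j) =
      (List.range a).filter fun j => r.testBit j :=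
    List.filter_congr fun j hj => Nat.testBit_two_pow_add_gt (List.mem_range.1 hj) r
  rw [bitsDesc_eq_of_lt hlt, bitsDesc_eq_of_lt hr, List.range_succ, List.filter_append, hlow]
  simp [htop]

theorem muW_succ_two_pow_add (u : ℕ) {a r : ℕ} (hr : r < 2 ^ a) :
    muW (u + 1) (2 ^ a + r) = a + 2 + muW u r := by
  simp [muW, bitsDesc_two_pow_add hr]

theorem sum_range_two_pow_succ_muW (u n : ℕ) :
    ∑ k ∈ range (2 ^ (n + 1)), ((2 : ℝ) ^ muW (u + 1) k)⁻¹ =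
      ∑ k ∈ range (2 ^ n), ((2 : ℝ) ^ muW (u + 1) k)⁻¹ +
        ((2 : ℝ) ^ (n + 2))⁻¹ * ∑ k ∈ range (2 ^ n), ((2 : ℝ) ^ muW u k)⁻¹ := by
  rw [pow_succ 2 n, mul_two, sum_range_add, mul_sum]
  congr 1
  refine sum_congr rfl fun r hr => ?_
  rw [muW_succ_two_pow_add u (mem_range.1 hr), pow_add _ (n + 2), mul_inv]

theorem sum_range_two_pow_muW_one (n : ℕ) :
    ∑ k ∈ range (2 ^ n), ((2 : ℝ) ^ muW 1 k)⁻¹ = 1 + n / 4 := by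
  induction n with
  | zero => simp [muW, bitsDesc]
  | succ n ih =>
    rw [sum_range_two_pow_succ_muW, ih]
    simp only [muW, List.take_zero, List.map_nil, List.sum_nil, pow_zero, inv_one, sum_const,
      card_range, nsmul_eq_mul]
    push_cast
    field_simp
    ring

theorem sum_range_two_pow_muW_two (n : ℕ) :
    ∑ k ∈ range (2 ^ n), ((2 : ℝ) ^ muW 2 k)⁻¹ =
      1 + (∑ a ∈ range n, ((2 : ℝ) ^ (a + 2))⁻¹ +
        ∑ l ∈ range n, (l : ℝ) * ((2 : ℝ) ^ (l + 4))⁻¹) := by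
  induction n with
  | zero => simp [muW, bitsDesc]
  | succ n ih =>
    rw [sum_range_two_pow_succ_muW, ih, sum_range_two_pow_muW_one, sum_range_succ _ n,
      sum_range_succ _ n]
    field_simp
    ring

theorem hasSum_inv_two_pow_add_two : HasSum (fun a : ℕ => ((2 : ℝ) ^ (a + 2))⁻¹) (1 / 2) := by
  have h : (fun a : ℕ => ((2 : ℝ) ^ (a + 2))⁻¹) = fun a => 1 / 4 * (1 / 2) ^ a := by
    ext a
    rw [pow_add, one_div_pow]
    field_simp
    norm_num
  rw [h]
  have hsum := hasSum_geometric_two.mul_left (1 / 4 : ℝ)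
  rwa [show (1 / 4 * 2 : ℝ) = 1 / 2 by norm_num] at hsum

theorem summable_mul_inv_two_pow_add_four :
    Summable fun l : ℕ => (l : ℝ) * ((2 : ℝ) ^ (l + 4))⁻¹ := by
  have h := (hasSum_coe_mul_geometric_of_norm_lt_one (r := (1 / 2 : ℝ)) (by norm_num)).summable
  refine (h.mul_left (1 / 16 : ℝ)).congr fun l => ?_
  rw [pow_add, one_div_pow]
  field_simp
  ring

theorem hasSum_inv_two_pow_muW_two :
    HasSum (fun k : ℕ => ((2 : ℝ) ^ muW 2 k)⁻¹)
      (1 + (1 / 2 + ∑' l : ℕ, (l : ℝ) * ((2 : ℝ) ^ (l + 4))⁻¹)) := by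
  have hnonneg : ∀ k : ℕ, 0 ≤ ((2 : ℝ) ^ muW 2 k)⁻¹ := fun k => by positivity
  have hmono : Monotone fun n : ℕ => ∑ k ∈ range n, ((2 : ℝ) ^ muW 2 k)⁻¹ :=
    (sum_mono_set_of_nonneg hnonneg).comp range_mono
  rw [hasSum_iff_tendsto_nat_of_nonneg hnonneg,
    tendsto_iff_tendsto_subseq_of_monotone hmono
      (tendsto_pow_atTop_atTop_of_one_lt one_lt_two)]
  refine Filter.Tendsto.congr (fun n => (sum_range_two_pow_muW_two n).symm) ?_
  exact tendsto_const_nhds.add (hasSum_inv_two_pow_add_two.tendsto_sum_nat.add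
    summable_mul_inv_two_pow_add_four.hasSum.tendsto_sum_nat)

/-- `∑_{k≥1} 2^{-μ'₂(k)}` converges and
`1 + ∑_{k≥1} 2^{-μ'₂(k)} = 3/2 + ∑_{l≥0} l ⋅ 2^{-l-4}`. -/
theorem stmt18 :
    Summable (fun k : ℕ => ((2 : ℝ) ^ muW 2 (k + 1))⁻¹) ∧
      1 + ∑' k : ℕ, ((2 : ℝ) ^ muW 2 (k + 1))⁻¹ =
        3 / 2 + ∑' l : ℕ, (l : ℝ) * ((2 : ℝ) ^ (l + 4))⁻¹ := by
  have h := hasSum_inv_two_pow_muW_two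
  refine ⟨(summable_nat_add_iff (f := fun k : ℕ => ((2 : ℝ) ^ muW 2 k)⁻¹) 1).2 h.summable, ?_⟩
  have hzero : muW 2 0 = 0 := by simp [muW, bitsDesc]
  have htsum := h.summable.tsum_eq_zero_add
  rw [h.tsum_eq, hzero, pow_zero, inv_one] at htsum
  rw [← htsum]
  ring

end
end
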